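/- Elfving bound used in the proof of Theorem 2.1: Let xi = {(x_i, p_i)}_{i=1}^n be a design in R^k (p_i >= 0, sum_i p_i = 1), let eps_i be signs in {-1, +1}, and set z = sum_{i=1}^n p_i eps_i x_i. Suppose z = gamma * c for some nonzero real gamma and some nonzero c in R^k, and suppose c is estimable under xi. Then Psi(xi) <= ||c||^2 / ||z||^2, where ||.|| is the Euclidean norm. -/

import Mathlib

open Matrix BigOperators

/-- The information matrix of a design with points `x i` and weights `p i`. -/
noncomputable def infoMat {k n : ℕ} (x : Fin n → Fin k → ℝ) (p : Fin n → ℝ) :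
    Matrix (Fin k) (Fin k) ℝ :=
  ∑ i, p i • vecMulVec (x i) (x i)

theorem infoMat_mulVec {k n : ℕ} (x : Fin n → Fin k → ℝ) (p : Fin n → ℝ) (d : Fin k → ℝ) :
    infoMat x p *ᵥ d = ∑ i, (p i * (x i ⬝ᵥ d)) • x i := by
  simp [infoMat, sum_mulVec, smul_mulVec, vecMulVec_mulVec, smul_smul]

theorem infoMat_mulVec_dotProduct {k n : ℕ} (x : Fin n → Fin k → ℝ) (p : Fin n → ℝ)
    (d : Fin k → ℝ) : (infoMat x p *ᵥ d) ⬝ᵥ d = ∑ i, p i * (x i ⬝ᵥ d) ^ 2 := by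
  rw [infoMat_mulVec, sum_dotProduct]
  simp only [smul_dotProduct, smul_eq_mul]
  exact Finset.sum_congr rfl fun i _ => by ring

/-- Elfving bound used in the proof of Theorem 2.1: if `ξ = {(x_i, p_i)}`
is a design, `ε_i ∈ {-1, +1}`, `z = ∑ i p_i ε_i x_i` lies on the ray through the nonzero
vector `c` (with nonzero coefficient), and `c` is estimable under `ξ`, then
`Ψ(ξ) ≤ ‖c‖²/‖z‖²`, where `Ψ(ξ) = cᵀ d` for any `d` with `M(ξ) d = c` and
`‖v‖² = v ⬝ᵥ v` is the squared Euclidean norm. -/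
theorem elfving_bound {k n : ℕ} (hk : 1 ≤ k)
    (c : Fin k → ℝ) (hc : c ≠ 0)
    (x : Fin n → Fin k → ℝ) (p : Fin n → ℝ)
    (hp : ∀ i, 0 ≤ p i) (hpsum : ∑ i, p i = 1)
    (ε : Fin n → ℝ) (hε : ∀ i, ε i = 1 ∨ ε i = -1)
    (z : Fin k → ℝ) (hz : z = ∑ i, (p i * ε i) • x i)
    (γ : ℝ) (hγ : γ ≠ 0) (hzc : z = γ • c) :
    ∀ d : Fin k → ℝ, (infoMat x p) *ᵥ d = c →
      c ⬝ᵥ d ≤ (c ⬝ᵥ c) / (z ⬝ᵥ z) := by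
  intro d hd
  have hcd : c ⬝ᵥ d = ∑ i, p i * (x i ⬝ᵥ d) ^ 2 := by
    rw [← infoMat_mulVec_dotProduct, hd]
  have hzd : γ * (c ⬝ᵥ d) = ∑ i, p i * ε i * (x i ⬝ᵥ d) := by
    have h := congrArg (· ⬝ᵥ d) (hzc.symm.trans hz)
    simpa only [smul_dotProduct, sum_dotProduct, smul_eq_mul] using h
  have hsq : ∑ i, p i * (ε i - γ * (x i ⬝ᵥ d)) ^ 2 = 1 - γ ^ 2 * (c ⬝ᵥ d) := by
    have hexp : ∀ i, p i * (ε i - γ * (x i ⬝ᵥ d)) ^ 2 =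
        p i - 2 * γ * (p i * ε i * (x i ⬝ᵥ d)) + γ ^ 2 * (p i * (x i ⬝ᵥ d) ^ 2) := by
      intro i
      have hεi : ε i ^ 2 = 1 := by rcases hε i with h | h <;> simp [h]
      linear_combination p i * hεi
    simp only [hexp, Finset.sum_add_distrib, Finset.sum_sub_distrib, ← Finset.mul_sum]
    rw [hpsum, ← hzd, ← hcd]
    ring
  have hnonneg : 0 ≤ 1 - γ ^ 2 * (c ⬝ᵥ d) :=
    hsq ▸ Finset.sum_nonneg fun i _ => mul_nonneg (hp i) (sq_nonneg _)
  have hcc : 0 < c ⬝ᵥ c :=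
    (Finset.sum_nonneg fun i _ => mul_self_nonneg (c i)).lt_of_ne'
      (mt dotProduct_self_eq_zero.mp hc)
  have hzz : z ⬝ᵥ z = γ ^ 2 * (c ⬝ᵥ c) := by
    rw [hzc, smul_dotProduct, dotProduct_smul, smul_eq_mul, smul_eq_mul]
    ring
  rw [hzz, le_div_iff₀ (by positivity)]
  nlinarith
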